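/- For any complex n×n density matrix σ, the decomposition entropy equals the von Neumann entropy: the infimum of H(p₁,…,pₘ), taken over all finite decompositions σ = ∑ᵢ₌₁^m pᵢ·σᵢ where (pᵢ) is a probability vector and each σᵢ is a pure state (rank-one orthogonal projection), is equal to S(σ), and the infimum is attained by a spectral decomposition of σ. -/

import Mathlib

open Matrix
open scoped ComplexOrder

/-- Applying a real function `f` to a matrix via the continuous functional calculus
(spectral decomposition); `0` for non-Hermitian input. -/
noncomputable def matFun (f : ℝ → ℝ) {ι : Type*} [Fintype ι] [DecidableEq ι]
    (A : Matrix ι ι ℂ) : Matrix ι ι ℂ :=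
  if hA : A.IsHermitian then
    (Matrix.IsHermitian.eigenvectorUnitary hA : Matrix ι ι ℂ) *
      Matrix.diagonal (fun i => (f (hA.eigenvalues i) : ℂ)) *
      (star (Matrix.IsHermitian.eigenvectorUnitary hA) : Matrix ι ι ℂ)
  else 0

/-- Von Neumann entropy `S(σ) = -tr (σ log σ)`, with the convention `0 log 0 = 0`. -/
noncomputable def vnEntropy {ι : Type*} [Fintype ι] [DecidableEq ι]
    (σ : Matrix ι ι ℂ) : ℝ :=
  -((σ * matFun Real.log σ).trace).re

/-- Shannon entropy of a probability vector, with the convention `0 log 0 = 0`. -/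
noncomputable def shannonEntropy {m : ℕ} (p : Fin m → ℝ) : ℝ :=
  -∑ i, p i * Real.log (p i)

lemma aux_pure {n : ℕ} (T : Matrix (Fin n) (Fin n) ℂ) (hH : T.IsHermitian)
    (hI : T * T = T) (htr : T.trace = 1) :
    ∃ v : Fin n → ℂ, (∀ j k, T j k = v j * star (v k)) ∧ ∑ j, Complex.normSq (v j) = 1 := by
  have hsp := hH.spectral_theorem
  rw [Unitary.conjStarAlgAut_apply] at hsp
  set U := hH.eigenvectorUnitary with hU
  have hUU : (star U : Matrix (Fin n) (Fin n) ℂ) * (U : Matrix (Fin n) (Fin n) ℂ) = 1 :=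
    Unitary.coe_star_mul_self U
  have hev : ∀ i, hH.eigenvalues i = 0 ∨ hH.eigenvalues i = 1 := by
    intro i
    have h1 := hH.mulVec_eigenvectorBasis i
    have h2 : (T * T) *ᵥ (hH.eigenvectorBasis i : Fin n → ℂ)
        = hH.eigenvalues i • hH.eigenvalues i • (hH.eigenvectorBasis i : Fin n → ℂ) := by
      rw [← Matrix.mulVec_mulVec, h1, Matrix.mulVec_smul, h1]
    rw [hI, h1, smul_smul] at h2
    have hne : (hH.eigenvectorBasis i : Fin n → ℂ) ≠ 0 := by
      intro h0
      apply hH.eigenvectorBasis.orthonormal.ne_zero i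
      ext j
      simpa using congrFun h0 j
    have h3 := smul_left_injective ℝ hne h2
    have h4 : hH.eigenvalues i * (hH.eigenvalues i - 1) = 0 := by linarith
    rcases mul_eq_zero.mp h4 with h | h
    · exact Or.inl h
    · right; linarith
  have hsum : ∑ i, hH.eigenvalues i = 1 := by
    have := hH.trace_eq_sum_eigenvalues
    rw [htr] at this
    exact_mod_cast (show ((∑ i, hH.eigenvalues i : ℝ) : ℂ) = 1 by rw [this]; push_cast; rfl)
  have hnn : ∀ i, 0 ≤ hH.eigenvalues i := fun i => by
    rcases hev i with h | h <;> rw [h] <;> norm_num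
  obtain ⟨i₀, hi₀⟩ : ∃ i, hH.eigenvalues i = 1 := by
    by_contra! hcon
    have : ∑ i, hH.eigenvalues i = 0 :=
      Finset.sum_eq_zero fun i _ => (hev i).resolve_right (hcon i)
    linarith
  have hoth : ∀ i, i ≠ i₀ → hH.eigenvalues i = 0 := by
    intro i hi
    have h1 := Finset.add_sum_erase Finset.univ hH.eigenvalues (Finset.mem_univ i₀)
    rw [hsum, hi₀] at h1
    have h2 : ∑ x ∈ Finset.univ.erase i₀, hH.eigenvalues x = 0 := by linarith
    exact (Finset.sum_eq_zero_iff_of_nonneg fun i _ => hnn i).mp h2 i (by simp [hi])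
  have hT : ∀ j k, T j k = (U : Matrix (Fin n) (Fin n) ℂ) j i₀
      * star ((U : Matrix (Fin n) (Fin n) ℂ) k i₀) := by
    intro j k
    conv_lhs => rw [hsp]
    rw [Matrix.mul_apply, Finset.sum_eq_single i₀]
    · simp [hi₀, Matrix.star_apply]
    · intro b _ hb
      simp [hoth b hb]
    · simp
  refine ⟨fun j => (U : Matrix (Fin n) (Fin n) ℂ) j i₀, hT, ?_⟩
  have h5 : (∑ j, (Complex.normSq ((U : Matrix (Fin n) (Fin n) ℂ) j i₀) : ℂ)) = 1 := by
    rw [← htr, Matrix.trace]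
    refine Finset.sum_congr rfl fun j _ => ?_
    rw [Matrix.diag_apply, hT, ← Complex.mul_conj]
    rfl
  exact_mod_cast h5

lemma aux_core {n m : ℕ} (l : Fin n → ℝ) (p : Fin m → ℝ) (v : Fin m → Fin n → ℂ)
    (hp : ∀ i, 0 ≤ p i)
    (hv : ∀ i, ∑ j, Complex.normSq (v i j) = 1)
    (hd : ∀ j k, (if j = k then (l j : ℂ) else 0) = ∑ i, (p i : ℂ) * (v i j * star (v i k))) :
    ∑ i, p i * Real.log (p i) ≤ ∑ j, l j * Real.log (l j) := by
  have hl : ∀ j, l j = ∑ i, p i * Complex.normSq (v i j) := by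
    intro j
    have h := hd j j
    rw [if_pos rfl] at h
    have h2 : (l j : ℂ) = ∑ i, (p i : ℂ) * (Complex.normSq (v i j) : ℂ) := by
      rw [h]
      refine Finset.sum_congr rfl fun i _ => ?_
      rw [← Complex.mul_conj]; rfl
    exact_mod_cast h2
  have hl0 : ∀ j, 0 ≤ l j := fun j => by
    rw [hl j]
    exact Finset.sum_nonneg fun i _ => mul_nonneg (hp i) (Complex.normSq_nonneg _)
  have hquad : ∀ w : Fin n → ℂ, ∑ i, p i * Complex.normSq (∑ j, star (v i j) * w j)
      = ∑ j, l j * Complex.normSq (w j) := by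
    intro w
    have h : (∑ i, (p i : ℂ) * (Complex.normSq (∑ j, star (v i j) * w j) : ℂ))
        = ∑ j, (l j : ℂ) * (Complex.normSq (w j) : ℂ) := by
      have e1 : ∀ i, (p i : ℂ) * (Complex.normSq (∑ j, star (v i j) * w j) : ℂ)
          = ∑ k, ∑ j, (w k * star (w j)) * ((p i : ℂ) * (v i j * star (v i k))) := by
        intro i
        rw [← Complex.mul_conj, map_sum, Finset.sum_mul_sum, Finset.mul_sum]
        refine Finset.sum_congr rfl fun k _ => ?_
        rw [Finset.mul_sum]
        refine Finset.sum_congr rfl fun j _ => ?_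
        simp only [map_mul, Complex.star_def, Complex.conj_conj]
        ring
      simp_rw [e1]
      rw [Finset.sum_comm]
      refine Finset.sum_congr rfl fun k _ => ?_
      rw [Finset.sum_comm]
      simp_rw [← Finset.mul_sum, ← hd]
      simp only [mul_ite, mul_zero, Finset.sum_ite_eq', Finset.mem_univ, if_true]
      rw [← Complex.mul_conj, Complex.star_def]
      ring
    exact_mod_cast h
  have hq : ∀ i, p i * ∑ j, Complex.normSq (v i j) / l j ≤ 1 := by
    intro i
    set q := ∑ j, Complex.normSq (v i j) / l j with hqdef
    have hq0 : 0 ≤ q := Finset.sum_nonneg fun j _ => div_nonneg (Complex.normSq_nonneg _) (hl0 j)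
    have h := hquad (fun j => v i j / (l j : ℂ))
    have hr : ∑ j, l j * Complex.normSq (v i j / (l j : ℂ)) = q := by
      refine Finset.sum_congr rfl fun j _ => ?_
      rw [Complex.normSq_div, Complex.normSq_ofReal]
      by_cases h0 : l j = 0
      · simp [h0]
      · field_simp
    have hin : ∑ j, star (v i j) * (v i j / (l j : ℂ)) = (q : ℂ) := by
      rw [hqdef]
      push_cast
      refine Finset.sum_congr rfl fun j _ => ?_
      rw [← Complex.mul_conj, Complex.star_def]
      ring
    have hle := Finset.single_le_sum (s := Finset.univ)
      (f := fun i' => p i' * Complex.normSq (∑ j, star (v i' j) * (v i j / (l j : ℂ))))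
      (fun i' _ => mul_nonneg (hp i') (Complex.normSq_nonneg _)) (Finset.mem_univ i)
    rw [h, hr, hin, Complex.normSq_ofReal] at hle
    by_contra! hc
    have : 0 < q := by
      rcases hq0.eq_or_lt with h0 | h0
      · rw [← h0] at hc; norm_num at hc
      · exact h0
    nlinarith
  have hterm : ∀ i j, p i * Complex.normSq (v i j) * (Real.log (p i) - Real.log (l j))
      ≤ p i * (p i * (Complex.normSq (v i j) / l j) - Complex.normSq (v i j)) := by
    intro i j
    rcases (hp i).eq_or_lt with h0 | h0
    · simp [← h0]
    rcases (Complex.normSq_nonneg (v i j)).eq_or_lt with h1 | h1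
    · simp [← h1]
    have hlj : 0 < l j := by
      rw [hl j]
      exact lt_of_lt_of_le (mul_pos h0 h1) (Finset.single_le_sum
        (f := fun i => p i * Complex.normSq (v i j))
        (fun i _ => mul_nonneg (hp i) (Complex.normSq_nonneg _)) (Finset.mem_univ i))
    have h2 := Real.log_le_sub_one_of_pos (div_pos h0 hlj)
    rw [Real.log_div h0.ne' hlj.ne'] at h2
    calc _ ≤ p i * Complex.normSq (v i j) * (p i / l j - 1) :=
          mul_le_mul_of_nonneg_left h2 (mul_pos h0 h1).le
      _ = _ := by ring
  have hL : ∑ i, p i * Real.log (p i)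
      = ∑ i, ∑ j, p i * Complex.normSq (v i j) * Real.log (p i) := by
    refine Finset.sum_congr rfl fun i _ => ?_
    rw [← Finset.sum_mul, ← Finset.mul_sum, hv i, mul_one]
  have hR : ∑ j, l j * Real.log (l j)
      = ∑ i, ∑ j, p i * Complex.normSq (v i j) * Real.log (l j) := by
    rw [Finset.sum_comm]
    refine Finset.sum_congr rfl fun j _ => ?_
    rw [← Finset.sum_mul, ← hl j]
  rw [hL, hR]
  refine Finset.sum_le_sum fun i _ => ?_
  rw [← sub_nonpos, ← Finset.sum_sub_distrib]
  simp_rw [← mul_sub]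
  refine (Finset.sum_le_sum fun j _ => hterm i j).trans ?_
  rw [← Finset.mul_sum, Finset.sum_sub_distrib, hv i, ← Finset.mul_sum]
  exact mul_nonpos_of_nonneg_of_nonpos (hp i) (by linarith [hq i])

lemma aux_vn {n : ℕ} (σ : Matrix (Fin n) (Fin n) ℂ) (hH : σ.IsHermitian) :
    vnEntropy σ = -∑ j, hH.eigenvalues j * Real.log (hH.eigenvalues j) := by
  have hsp := hH.spectral_theorem
  rw [Unitary.conjStarAlgAut_apply] at hsp
  unfold vnEntropy matFun
  rw [dif_pos hH]
  set U := hH.eigenvectorUnitary with hU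
  have hUU : (star U : Matrix (Fin n) (Fin n) ℂ) * (U : Matrix (Fin n) (Fin n) ℂ) = 1 :=
    Unitary.coe_star_mul_self U
  set L := Matrix.diagonal (fun i => (Real.log (hH.eigenvalues i) : ℂ))
  have e : σ * ((U : Matrix (Fin n) (Fin n) ℂ) * L * (star U : Matrix (Fin n) (Fin n) ℂ))
      = (U : Matrix (Fin n) (Fin n) ℂ) * (Matrix.diagonal (RCLike.ofReal ∘ hH.eigenvalues) * L)
        * (star U : Matrix (Fin n) (Fin n) ℂ) := by
    conv_lhs => rw [hsp]
    simp only [Matrix.mul_assoc]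
    rw [← Matrix.mul_assoc (star U : Matrix (Fin n) (Fin n) ℂ) (U : Matrix (Fin n) (Fin n) ℂ), hUU, Matrix.one_mul]
  rw [e, Matrix.trace_mul_comm, ← Matrix.mul_assoc, hUU, Matrix.one_mul,
    Matrix.diagonal_mul_diagonal, Matrix.trace_diagonal]
  simp

/-- the decomposition entropy equals the von Neumann entropy.
For a density matrix `σ`, the infimum of the Shannon entropies `H(p)` over all
finite decompositions `σ = ∑ i, p i • σ i` into pure states (rank-one orthogonal
projections, i.e. Hermitian idempotents of trace 1) equals `S(σ)`, and the infimum
is attained (in particular by a spectral decomposition of `σ`). -/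
theorem decomposition_entropy_eq_vnEntropy {n : ℕ}
    (σ : Matrix (Fin n) (Fin n) ℂ)
    (hσ : σ.PosSemidef) (hσtr : σ.trace = 1) :
    IsLeast {x : ℝ | ∃ (m : ℕ) (p : Fin m → ℝ) (τ : Fin m → Matrix (Fin n) (Fin n) ℂ),
        (∀ i, 0 ≤ p i) ∧ (∑ i, p i = 1) ∧
        (∀ i, (τ i).IsHermitian ∧ τ i * τ i = τ i ∧ (τ i).trace = 1) ∧
        σ = ∑ i, p i • τ i ∧ x = shannonEntropy p}
      (vnEntropy σ) := by
  have hH := hσ.1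
  have hsp := hH.spectral_theorem
  rw [Unitary.conjStarAlgAut_apply] at hsp
  rw [aux_vn σ hH]
  set U := hH.eigenvectorUnitary with hU
  have hUU : (star U : Matrix (Fin n) (Fin n) ℂ) * (U : Matrix (Fin n) (Fin n) ℂ) = 1 :=
    Unitary.coe_star_mul_self U
  have hUU' : (U : Matrix (Fin n) (Fin n) ℂ) * (star U : Matrix (Fin n) (Fin n) ℂ) = 1 :=
    Unitary.coe_mul_star_self U
  generalize hV : (U : Matrix (Fin n) (Fin n) ℂ) = V at *
  constructor
  · refine ⟨n, hH.eigenvalues, fun i => V * Matrix.diagonal (Pi.single i 1) * star V,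
      hσ.eigenvalues_nonneg, ?_, ?_, ?_, rfl⟩
    · have := hH.trace_eq_sum_eigenvalues
      rw [hσtr] at this
      exact_mod_cast (show ((∑ i, hH.eigenvalues i : ℝ) : ℂ) = 1 by rw [this]; push_cast; rfl)
    · intro i
      refine ⟨?_, ?_, ?_⟩
      · refine Matrix.isHermitian_mul_mul_conjTranspose V ?_
        refine Matrix.isHermitian_diagonal_of_self_adjoint _ ?_
        ext j
        by_cases h : j = i
        · subst h; simp
        · simp [h]
      · simp only [Matrix.mul_assoc]
        rw [← Matrix.mul_assoc (star V) V, hUU, Matrix.one_mul,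
          ← Matrix.mul_assoc (Matrix.diagonal _) (Matrix.diagonal _),
          Matrix.diagonal_mul_diagonal]
        congr 3
        ext j
        by_cases h : j = i
        · subst h; simp
        · simp [h]
      · rw [Matrix.trace_mul_comm, ← Matrix.mul_assoc, hUU, Matrix.one_mul,
          Matrix.trace_diagonal]
        simp
    · conv_lhs => rw [hsp]
      have hs : ∀ i (M N : Matrix (Fin n) (Fin n) ℂ) (c : Fin n → ℝ), c i • (M * N * star V)
          = M * (c i • N) * star V := by intro i M N c; rw [Matrix.mul_smul, Matrix.smul_mul]
      simp_rw [hs]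
      rw [← Finset.sum_mul, ← Finset.mul_sum]
      congr 2
      ext j k
      rw [Matrix.sum_apply]
      by_cases h : j = k
      · subst h
        simp [Matrix.smul_apply, Pi.single_apply]
      · simp [Matrix.smul_apply, h]
  · rintro x ⟨m, p, τ, hp, hp1, hτ, hdec, rfl⟩
    have hpure : ∀ i, ∃ v : Fin n → ℂ, (∀ j k, (star V * τ i * V) j k = v j * star (v k)) ∧
        ∑ j, Complex.normSq (v j) = 1 := by
      intro i
      obtain ⟨h1, h2, h3⟩ := hτ i
      apply aux_pure
      · exact Matrix.isHermitian_conjTranspose_mul_mul V h1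
      · simp only [Matrix.mul_assoc]
        rw [← Matrix.mul_assoc V (star V), hUU', Matrix.one_mul,
          ← Matrix.mul_assoc (τ i) (τ i), h2]
      · rw [Matrix.trace_mul_comm, ← Matrix.mul_assoc, hUU', Matrix.one_mul, h3]
    choose v hv1 hv2 using hpure
    unfold shannonEntropy
    refine neg_le_neg (aux_core hH.eigenvalues p v hp hv2 ?_)
    have hD : Matrix.diagonal (RCLike.ofReal ∘ hH.eigenvalues) = ∑ i, p i • (star V * τ i * V) := by
      have hs : ∀ (M : Matrix (Fin n) (Fin n) ℂ) (c : ℝ), c • (star V * M * V)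
          = star V * (c • M) * V := by intro M c; rw [Matrix.mul_smul, Matrix.smul_mul]
      simp_rw [hs]
      rw [← Finset.sum_mul, ← Finset.mul_sum, ← hdec]
      conv_rhs => rw [hsp]
      simp only [Matrix.mul_assoc]
      rw [hUU, Matrix.mul_one, ← Matrix.mul_assoc, hUU, Matrix.one_mul]
    intro j k
    have := congrFun (congrFun hD j) k
    rw [Matrix.sum_apply] at this
    simp only [Matrix.smul_apply, hv1, Matrix.diagonal_apply, Complex.real_smul] at this
    exact this
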